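/- In the FOSLS setting under the Carleman hypothesis, let X^δ ⊆ X, Z^δ ⊆ Z and Ȳ^δ ⊆ Y be subspaces, and let Q̄ : Y → Y be a bounded linear map with range contained in Ȳ^δ and with C(w,q)(μ − Q̄μ) = 0 for all (w,q) ∈ X^δ × Z^δ and all μ ∈ Y (a Fortin operator); set ē_osc(g) := ‖g ∘ (Id − Q̄)‖_{Y'}. If ε ≥ 0 and (ū_ε, p_ε) ∈ X × Z satisfies H_ε(ū_ε, p_ε) ≤ H_ε(v,r) for all (v,r) ∈ X × Z, then for every (w,q) ∈ X^δ × Z^δ: N(ū_ε − w) ≤ 2√2·C_η·(max(1, ‖Q̄‖)·√(H_ε^δ(w,q)) + ē_osc(g)), where H_ε^δ(w,q) := ‖C(w,q) − g‖²_{(Ȳ^δ)'} + ‖q − ∇_K w‖²_Z + ‖Γw − f‖²_{H_ω} + ε²‖γ₀w‖²_{H₀}. -/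

import Mathlib

/-- The discrete dual norm `‖ℓ‖_{(Ȳ^δ)'} = sup { ℓ μ : μ ∈ Ȳ^δ, ‖μ‖ ≤ 1 }`. -/
noncomputable def discreteDualNorm {Y : Type*} [NormedAddCommGroup Y]
    [InnerProductSpace ℝ Y] (Yδ : Submodule ℝ Y) (ℓ : Y →L[ℝ] ℝ) : ℝ :=
  sSup ((fun μ => ℓ μ) '' {μ : Y | μ ∈ Yδ ∧ ‖μ‖ ≤ 1})

theorem discreteDualNorm_nonneg {Y : Type*} [NormedAddCommGroup Y] [InnerProductSpace ℝ Y]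
    (Yδ : Submodule ℝ Y) (ℓ : Y →L[ℝ] ℝ) : 0 ≤ discreteDualNorm Yδ ℓ := by
  refine le_csSup ⟨‖ℓ‖, ?_⟩ ⟨0, ⟨Yδ.zero_mem, by simp⟩, by simp⟩
  rintro _ ⟨μ, ⟨-, hμ⟩, rfl⟩
  exact (le_abs_self _).trans (ℓ.unit_le_opNorm μ hμ)

theorem apply_le_discreteDualNorm_mul {Y : Type*} [NormedAddCommGroup Y]
    [InnerProductSpace ℝ Y] (Yδ : Submodule ℝ Y) (ℓ : Y →L[ℝ] ℝ) {μ : Y} (hμ : μ ∈ Yδ) :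
    ℓ μ ≤ discreteDualNorm Yδ ℓ * ‖μ‖ := by
  rcases eq_or_ne μ 0 with rfl | h0
  · simp
  have hpos : 0 < ‖μ‖ := norm_pos_iff.mpr h0
  have key : ℓ (‖μ‖⁻¹ • μ) ≤ discreteDualNorm Yδ ℓ := by
    refine le_csSup ⟨‖ℓ‖, ?_⟩ ⟨_, ⟨Yδ.smul_mem _ hμ, ?_⟩, rfl⟩
    · rintro _ ⟨ν, ⟨-, hν⟩, rfl⟩
      exact (le_abs_self _).trans (ℓ.unit_le_opNorm ν hν)
    · rw [norm_smul, norm_inv, norm_norm, inv_mul_cancel₀ hpos.ne']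
  rw [map_smul, smul_eq_mul, inv_mul_eq_div, div_le_iff₀ hpos] at key
  exact key

theorem abs_apply_le_discreteDualNorm_mul {Y : Type*} [NormedAddCommGroup Y]
    [InnerProductSpace ℝ Y] (Yδ : Submodule ℝ Y) (ℓ : Y →L[ℝ] ℝ) {μ : Y} (hμ : μ ∈ Yδ) :
    |ℓ μ| ≤ discreteDualNorm Yδ ℓ * ‖μ‖ := by
  refine abs_le'.mpr ⟨apply_le_discreteDualNorm_mul Yδ ℓ hμ, ?_⟩
  simpa using apply_le_discreteDualNorm_mul Yδ ℓ (Yδ.neg_mem hμ)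

/-- A Fortin operator for `ℓ` bounds the dual norm of the residual `ℓ - g` by its discrete dual
norm, up to data oscillation. -/
theorem norm_sub_le_discreteDualNorm_add_osc {Y : Type*} [NormedAddCommGroup Y]
    [InnerProductSpace ℝ Y] (Yδ : Submodule ℝ Y) (Q : Y →L[ℝ] Y) (hran : ∀ μ, Q μ ∈ Yδ)
    (ℓ g : Y →L[ℝ] ℝ) (hℓ : ∀ μ, ℓ (μ - Q μ) = 0) :
    ‖ℓ - g‖ ≤ ‖Q‖ * discreteDualNorm Yδ (ℓ - g) +
      ‖g.comp (ContinuousLinearMap.id ℝ Y - Q)‖ := by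
  have hd := discreteDualNorm_nonneg Yδ (ℓ - g)
  refine ContinuousLinearMap.opNorm_le_bound _ (by positivity) fun μ => ?_
  have hsplit : (ℓ - g) μ =
      (ℓ - g) (Q μ) - g.comp (ContinuousLinearMap.id ℝ Y - Q) μ := by
    have := hℓ μ
    simp only [map_sub] at this
    simp only [sub_apply, ContinuousLinearMap.comp_apply,
      ContinuousLinearMap.id_apply, map_sub]
    linarith
  have h1 := abs_apply_le_discreteDualNorm_mul Yδ (ℓ - g) (hran μ)
  have h2 := (g.comp (ContinuousLinearMap.id ℝ Y - Q)).le_opNorm μ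
  have h3 := mul_le_mul_of_nonneg_left (Q.le_opNorm μ) hd
  rw [hsplit]
  calc _ ≤ ‖(ℓ - g) (Q μ)‖ + ‖g.comp (ContinuousLinearMap.id ℝ Y - Q) μ‖ := norm_sub_le _ _
    _ ≤ _ := by rw [Real.norm_eq_abs ((ℓ - g) (Q μ))]; linarith

theorem norm_sub_sq_le_two_mul {E : Type*} [SeminormedAddCommGroup E] (a b : E) :
    ‖a - b‖ ^ 2 ≤ 2 * (‖a‖ ^ 2 + ‖b‖ ^ 2) :=
  (pow_le_pow_left₀ (norm_nonneg _) (norm_sub_le a b) 2).trans add_sq_le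

theorem sqrt_sq_add_le_of_le_mul_add {a d q o r : ℝ} (ha : 0 ≤ a) (hd : 0 ≤ d) (ho : 0 ≤ o)
    (hr : 0 ≤ r) (h : a ≤ q * d + o) :
    √(a ^ 2 + r) ≤ max 1 q * √(d ^ 2 + r) + o := by
  set M := max 1 q
  have hM : 1 ≤ M := le_max_left _ _
  set S := √(d ^ 2 + r)
  have hS : S ^ 2 = d ^ 2 + r := Real.sq_sqrt (by positivity)
  have hdS : d ≤ S := Real.le_sqrt_of_sq_le (by linarith)
  have haM : a ≤ M * d + o :=
    h.trans (by gcongr; exact le_max_right _ _)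
  refine Real.sqrt_le_iff.mpr ⟨by positivity, ?_⟩
  have h1 : a ^ 2 ≤ (M * d + o) ^ 2 := pow_le_pow_left₀ ha haM 2
  have h2 : r ≤ M ^ 2 * r := le_mul_of_one_le_left hr (one_le_pow₀ hM)
  have h3 : M * o * d ≤ M * o * S := mul_le_mul_of_nonneg_left hdS (by positivity)
  have h4 : M ^ 2 * S ^ 2 = M ^ 2 * (d ^ 2 + r) := by rw [hS]
  nlinarith

/-- Proposition 4.7: computable FOSLS a posteriori error bound via a Fortin operator. -/
theorem stmt_19
    {X Y Hω H₀ Z : Type*}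
    [NormedAddCommGroup X] [InnerProductSpace ℝ X] [CompleteSpace X]
    [NormedAddCommGroup Y] [InnerProductSpace ℝ Y] [CompleteSpace Y]
    [NormedAddCommGroup Hω] [InnerProductSpace ℝ Hω] [CompleteSpace Hω]
    [NormedAddCommGroup H₀] [InnerProductSpace ℝ H₀] [CompleteSpace H₀]
    [NormedAddCommGroup Z] [InnerProductSpace ℝ Z] [CompleteSpace Z]
    (B : X →L[ℝ] (Y →L[ℝ] ℝ)) (Γ : X →L[ℝ] Hω) (γ₀ : X →L[ℝ] H₀)
    (g : Y →L[ℝ] ℝ) (f : Hω)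
    (gradK : X →L[ℝ] Z) (D : Z →L[ℝ] (Y →L[ℝ] ℝ)) (hD : ‖D‖ ≤ 1)
    (N : Seminorm ℝ X) (Cη : ℝ) (hCη : 0 < Cη)
    (hCarl : ∀ w : X, N w ≤ Cη * Real.sqrt (‖B w‖ ^ 2 + ‖Γ w‖ ^ 2))
    (Xδ : Submodule ℝ X) (Zδ : Submodule ℝ Z) (Yδ : Submodule ℝ Y)
    (Q : Y →L[ℝ] Y)
    (hran : ∀ μ : Y, Q μ ∈ Yδ)
    (hFortin : ∀ w ∈ Xδ, ∀ q ∈ Zδ, ∀ μ : Y,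
      (B w + D (q - gradK w)) (μ - Q μ) = 0)
    (ε : ℝ) (hε : 0 ≤ ε) (uε : X) (pε : Z)
    (hmin : ∀ (v : X) (r : Z),
      ‖(B uε + D (pε - gradK uε)) - g‖ ^ 2 + ‖pε - gradK uε‖ ^ 2 +
          ‖Γ uε - f‖ ^ 2 + ε ^ 2 * ‖γ₀ uε‖ ^ 2 ≤
        ‖(B v + D (r - gradK v)) - g‖ ^ 2 + ‖r - gradK v‖ ^ 2 +
          ‖Γ v - f‖ ^ 2 + ε ^ 2 * ‖γ₀ v‖ ^ 2) :
    ∀ w ∈ Xδ, ∀ q ∈ Zδ,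
      N (uε - w) ≤ 2 * Real.sqrt 2 * Cη *
        (max 1 ‖Q‖ *
          Real.sqrt (discreteDualNorm Yδ ((B w + D (q - gradK w)) - g) ^ 2 +
            ‖q - gradK w‖ ^ 2 + ‖Γ w - f‖ ^ 2 + ε ^ 2 * ‖γ₀ w‖ ^ 2) +
         ‖g.comp (ContinuousLinearMap.id ℝ Y - Q)‖) := by
  intro w hw q hq
  have hfortin := norm_sub_le_discreteDualNorm_add_osc Yδ Q hran _ g (hFortin w hw q hq)
  have hd := discreteDualNorm_nonneg Yδ ((B w + D (q - gradK w)) - g)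
  have hm := hmin w q
  set R := (B w + D (q - gradK w)) - g with hR
  set Rε := (B uε + D (pε - gradK uε)) - g with hRε
  set z := q - gradK w with hz
  set zε := pε - gradK uε with hzε
  have hB : B (uε - w) = (Rε - R) - D (zε - z) := by
    rw [hR, hRε, map_sub B, map_sub D zε z]; abel
  have hΓ : Γ (uε - w) = (Γ uε - f) - (Γ w - f) := by rw [map_sub]; abel
  have hDz : ‖D (zε - z)‖ ^ 2 ≤ ‖zε - z‖ ^ 2 := by
    gcongr
    simpa using D.le_of_opNorm_le hD (zε - z)
  have h1 := norm_sub_sq_le_two_mul (Rε - R) (D (zε - z))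
  have h2 := norm_sub_sq_le_two_mul Rε R
  have h3 := norm_sub_sq_le_two_mul zε z
  have h4 := norm_sub_sq_le_two_mul (Γ uε - f) (Γ w - f)
  rw [← hB] at h1
  rw [← hΓ] at h4
  have hpos : 0 ≤ ε ^ 2 * ‖γ₀ uε‖ ^ 2 := by positivity
  have hpos' : 0 ≤ ε ^ 2 * ‖γ₀ w‖ ^ 2 := by positivity
  have hsum : ‖B (uε - w)‖ ^ 2 + ‖Γ (uε - w)‖ ^ 2 ≤
      2 ^ 2 * 2 * (‖R‖ ^ 2 + (‖z‖ ^ 2 + ‖Γ w - f‖ ^ 2 + ε ^ 2 * ‖γ₀ w‖ ^ 2)) := by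
    nlinarith [sq_nonneg ‖Γ uε - f‖, sq_nonneg ‖Γ w - f‖]
  have hsqrt := Real.sqrt_le_sqrt hsum
  rw [Real.sqrt_mul (by norm_num), Real.sqrt_mul (by norm_num),
    Real.sqrt_sq (by norm_num)] at hsqrt
  have hfinal := sqrt_sq_add_le_of_le_mul_add (norm_nonneg R) hd (norm_nonneg _)
    (by positivity : 0 ≤ ‖z‖ ^ 2 + ‖Γ w - f‖ ^ 2 + ε ^ 2 * ‖γ₀ w‖ ^ 2) hfortin
  simp only [← add_assoc] at hsqrt hfinal
  calc N (uε - w) ≤ Cη * √(‖B (uε - w)‖ ^ 2 + ‖Γ (uε - w)‖ ^ 2) := hCarl _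
    _ ≤ Cη * (2 * √2 * (max 1 ‖Q‖ * √(discreteDualNorm Yδ R ^ 2 + ‖z‖ ^ 2 + ‖Γ w - f‖ ^ 2 +
          ε ^ 2 * ‖γ₀ w‖ ^ 2) + ‖g.comp (ContinuousLinearMap.id ℝ Y - Q)‖)) := by
        gcongr
        exact hsqrt.trans (by gcongr)
    _ = _ := by ring
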